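/- Let h = 2n+1 be an odd integer with n ≥ 1, let 0 ≤ i ≤ n, and let σ be an h-bar-core having at least one addable i-node; assume moreover that either i ≠ 0, or i = 0 and σ has at least three addable 0-nodes. Then every partition in P_{σ,1} has no removable i-node. -/

import Mathlib

/-- A partition: a weakly decreasing sequence of non-negative integers with
finite sum (finitely many nonzero parts), indexed from 0 (so `parts 0` is λ₁). -/
structure BPartition where
  parts : ℕ →₀ ℕ
  antitone : ∀ r, parts (r + 1) ≤ parts r

namespace BPartition

/-- The multiset of positive parts of a partition. -/
def partsM (lam : BPartition) : Multiset ℕ :=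
  lam.parts.support.val.map (fun r => lam.parts r)

/-- The Young diagram: nodes `(r, c)` with rows indexed from 0 and columns from 1. -/
def diagram (lam : BPartition) : Set (ℕ × ℕ) :=
  {x | 1 ≤ x.2 ∧ x.2 ≤ lam.parts x.1}

/-- A partition is strict if λ_r > λ_{r+1} whenever λ_r > 0. -/
def IsStrict (lam : BPartition) : Prop :=
  ∀ r, 0 < lam.parts r → lam.parts (r + 1) < lam.parts r

/-- A partition is h-strict if each part is either strictly bigger than the next,
or positive and divisible by h, or zero. -/
def IsHStrict (h : ℕ) (lam : BPartition) : Prop :=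
  ∀ r, lam.parts (r + 1) < lam.parts r ∨ (0 < lam.parts r ∧ h ∣ lam.parts r) ∨ lam.parts r = 0

/-- An h-strict partition is restricted if for every r either λ_{r+1} > λ_r − h,
or λ_{r+1} = λ_r − h and h does not divide λ_r. -/
def IsRestricted (h : ℕ) (lam : BPartition) : Prop :=
  ∀ r, lam.parts r < lam.parts (r + 1) + h ∨
    (lam.parts (r + 1) + h = lam.parts r ∧ ¬ h ∣ lam.parts r)

/-- The residue of a node in column c (1-indexed): the smaller of the residues of
c − 1 and of −c modulo h. -/
def colRes (h c : ℕ) : ℕ := min ((c - 1) % h) ((h - c % h) % h)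

/-- `x` is an addable i-node of `lam`. -/
def Addable (h i : ℕ) (lam : BPartition) (x : ℕ × ℕ) : Prop :=
  colRes h x.2 = i ∧ x ∉ diagram lam ∧
  ∃ nu : BPartition, IsHStrict h nu ∧ diagram lam ⊆ diagram nu ∧ x ∈ diagram nu ∧
    ∀ y ∈ diagram nu, y ∉ diagram lam → colRes h y.2 = i

/-- `x` is a removable i-node of `lam`. -/
def Removable (h i : ℕ) (lam : BPartition) (x : ℕ × ℕ) : Prop :=
  x ∈ diagram lam ∧
  ∃ mu : BPartition, IsHStrict h mu ∧ diagram mu ⊆ diagram lam ∧ x ∉ diagram mu ∧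
    ∀ y ∈ diagram lam, y ∉ diagram mu → colRes h y.2 = i

/-- Removal of a single h-bar from `lam` giving `mu`, recording the value `v`:
either a part `v ≥ h` is replaced by `v − h` (deleted if `v = h`), or two parts
summing to `h` are deleted, in which case `v` is the larger of the two. -/
def barStepRec (h : ℕ) (lam mu : BPartition) (v : ℕ) : Prop :=
  IsHStrict h mu ∧
  ((v = h ∧ v ∈ partsM lam ∧ partsM mu = (partsM lam).erase v) ∨
   (h < v ∧ v ∈ partsM lam ∧ partsM mu = (v - h) ::ₘ (partsM lam).erase v) ∨
   (∃ a b : ℕ, a + b = h ∧ a ∈ partsM lam ∧ b ∈ (partsM lam).erase a ∧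
      v = max a b ∧ partsM mu = ((partsM lam).erase a).erase b))

/-- Removal of a single h-bar. -/
def barStep (h : ℕ) (lam mu : BPartition) : Prop :=
  ∃ v, barStepRec h lam mu v

/-- An h-bar-core: an h-strict partition from which no h-bar can be removed. -/
def IsBarCore (h : ℕ) (lam : BPartition) : Prop :=
  IsHStrict h lam ∧ ∀ mu, ¬ barStep h lam mu

/-- A chain of `w` h-bar removals from `lam` down to `mu`. -/
def barChain (h : ℕ) : ℕ → BPartition → BPartition → Prop
  | 0, lam, mu => lam = mu
  | w + 1, lam, mu => ∃ nu, barStep h lam nu ∧ barChain h w nu mu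

/-- `lam ∈ P_{τ,w}`: `lam` is h-strict with h-bar-core `tau` and h-bar-weight `w`. -/
def InBlock (h : ℕ) (tau : BPartition) (w : ℕ) (lam : BPartition) : Prop :=
  IsHStrict h lam ∧ IsBarCore h tau ∧ barChain h w lam tau

/-- The left-to-right order on node positions along the edge of a Young diagram:
smaller column first; within a column, larger row first. -/
def posLE (x y : ℕ × ℕ) : Prop := x.2 < y.2 ∨ (x.2 = y.2 ∧ y.1 ≤ x.1)

/-- `x` is a normal i-node: a removable i-node surviving (as a − sign) in the
reduced i-signature; equivalently, every window of the i-signature ending at `x`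
contains strictly more removable than addable i-nodes. -/
def Normal (h i : ℕ) (lam : BPartition) (x : ℕ × ℕ) : Prop :=
  Removable h i lam x ∧ ∀ z : ℕ × ℕ, posLE z x →
    Set.ncard {y | Addable h i lam y ∧ posLE z y ∧ posLE y x} <
      Set.ncard {y | Removable h i lam y ∧ posLE z y ∧ posLE y x}

/-- `x` is a conormal i-node: an addable i-node surviving (as a + sign) in the
reduced i-signature. -/
def Conormal (h i : ℕ) (lam : BPartition) (x : ℕ × ℕ) : Prop :=
  Addable h i lam x ∧ ∀ z : ℕ × ℕ, posLE x z →
    Set.ncard {y | Removable h i lam y ∧ posLE x y ∧ posLE y z} <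
      Set.ncard {y | Addable h i lam y ∧ posLE x y ∧ posLE y z}

/-- The node set of ψ_i(λ): add the leftmost s − r conormal i-nodes if s ≥ r,
remove the rightmost r − s normal i-nodes if r > s, where r = #normal and
s = #conormal i-nodes. -/
noncomputable def psiSet (h i : ℕ) (lam : BPartition) : Set (ℕ × ℕ) :=
  if Set.ncard {x | Normal h i lam x} ≤ Set.ncard {x | Conormal h i lam x} then
    diagram lam ∪ {x | Conormal h i lam x ∧
      Set.ncard {y | Conormal h i lam y ∧ posLE y x} ≤
        Set.ncard {x | Conormal h i lam x} - Set.ncard {x | Normal h i lam x}}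
  else
    diagram lam \ {x | Normal h i lam x ∧
      Set.ncard {y | Normal h i lam y ∧ posLE x y} ≤
        Set.ncard {x | Normal h i lam x} - Set.ncard {x | Conormal h i lam x}}

open Classical in
/-- The involution ψ_i. -/
noncomputable def psi (h i : ℕ) (lam : BPartition) : BPartition :=
  if hex : ∃ mu : BPartition, diagram mu = psiSet h i lam then hex.choose else lam

/-- The set of occupied positions of the abacus display of a strict partition. -/
def abacus (lam : BPartition) : Set ℤ :=
  {a | a = 0 ∨ (0 < a ∧ a.toNat ∈ partsM lam) ∨ (a < 0 ∧ (-a).toNat ∉ partsM lam)}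

/-- The dominance order: λ ⊴ μ. -/
def domLE (lam mu : BPartition) : Prop :=
  ∀ r, ∑ s ∈ Finset.range r, lam.parts s ≤ ∑ s ∈ Finset.range r, mu.parts s

/-- Strict dominance: λ ◁ μ. -/
def domLT (lam mu : BPartition) : Prop := domLE lam mu ∧ lam ≠ mu

/-- Lexicographic order: λ <lex μ. -/
def lexLT (lam mu : BPartition) : Prop :=
  ∃ r, lam.parts r < mu.parts r ∧ ∀ s < r, lam.parts s = mu.parts s

/-- Colexicographic order: λ <colex μ. -/
def colexLT (lam mu : BPartition) : Prop :=
  ∃ r, mu.parts r < lam.parts r ∧ ∀ s, r < s → lam.parts s = mu.parts s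

/-- λ ↔ᵢ μ: every node of the symmetric difference of the diagrams has residue i. -/
def Link (h i : ℕ) (lam mu : BPartition) : Prop :=
  ∀ x : ℕ × ℕ, x ∈ (diagram lam \ diagram mu) ∪ (diagram mu \ diagram lam) →
    colRes h x.2 = i

/-- `a ≤ b` are the bar positions of `lam ∈ P_{τ,2}`: the values recorded by
some two-step removal of h-bars from `lam` down to `tau`. -/
def BarPositions (h : ℕ) (tau lam : BPartition) (a b : ℕ) : Prop :=
  a ≤ b ∧ ∃ (nu : BPartition) (v₁ v₂ : ℕ), barStepRec h lam nu v₁ ∧ barStepRec h nu tau v₂ ∧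
    ({a, b} : Multiset ℕ) = {v₁, v₂}

/-- The leg length of the bar of `lam ∈ P_{τ,2}` at bar position `c`. -/
noncomputable def legLen (h : ℕ) (tau lam : BPartition) (c : ℕ) : ℕ :=
  if h ≤ c then Set.ncard {x : ℕ | c - h < x ∧ x < c ∧ x ∈ partsM lam ∧ x ∈ partsM tau}
  else (h - c) + Set.ncard {x : ℕ | h - c < x ∧ x < c ∧ x ∈ partsM lam ∧ x ∈ partsM tau}

/-- ∂λ: the absolute difference of the two leg lengths of `lam`, whose bar
positions are `a ≤ b`. -/
noncomputable def ddd (h : ℕ) (tau lam : BPartition) (a b : ℕ) : ℕ :=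
  max (legLen h tau lam a) (legLen h tau lam b) - min (legLen h tau lam a) (legLen h tau lam b)

inductive Colour | black | white | grey
deriving DecidableEq

/-- β(τ): the number of parts of τ less than h. -/
def betaCount (h : ℕ) (tau : BPartition) : ℕ :=
  Multiset.card ((partsM tau).filter (fun x => x < h))

/-- The leg length of a 2h-bar of `lam` with larger bar position `b`. -/
noncomputable def legLen2 (h : ℕ) (tau lam : BPartition) (b : ℕ) : ℕ :=
  if 2 * h ≤ b then Set.ncard {x : ℕ | b - 2 * h < x ∧ x < b ∧ x ∈ partsM lam ∧ x ∈ partsM tau}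
  else (2 * h - b) + Set.ncard {x : ℕ | 2 * h - b < x ∧ x < b ∧ x ∈ partsM lam ∧ x ∈ partsM tau}

/-- The colour of `lam ∈ P_{τ,2}` with bar positions `a ≤ b`. -/
noncomputable def colour (h : ℕ) (tau lam : BPartition) (a b : ℕ) : Colour :=
  if 2 ≤ ddd h tau lam a b then Colour.grey
  else if ddd h tau lam a b = 1 then
    if h < b then Colour.grey
    else if (min (legLen h tau lam a) (legLen h tau lam b) + betaCount h tau) % 2 = 1 then
      Colour.black else Colour.white
  else
    if b = a + h ∨ a + b = 2 * h then
      if (legLen2 h tau lam b + 2 * betaCount h tau) % 4 = 0 ∨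
         (legLen2 h tau lam b + 2 * betaCount h tau) % 4 = 3 then Colour.black
      else Colour.white
    else
      if (legLen h tau lam a + betaCount h tau) % 2 = 1 then Colour.black else Colour.white

end BPartition


namespace BPartition

lemma mem_partsM (lam : BPartition) (c : ℕ) :
    c ∈ partsM lam ↔ 0 < c ∧ ∃ r, lam.parts r = c := by
  unfold partsM
  simp only [Multiset.mem_map, Finset.mem_val, Finsupp.mem_support_iff]
  constructor
  · rintro ⟨r, h1, h2⟩
    exact ⟨by omega, r, h2⟩
  · rintro ⟨h1, r, h2⟩
    exact ⟨r, by omega, h2⟩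

lemma anti (lam : BPartition) {r s : ℕ} (hrs : r ≤ s) : lam.parts s ≤ lam.parts r :=
  antitone_nat_of_succ_le lam.antitone hrs

lemma hstrict_ne {h : ℕ} {lam : BPartition} (hs : IsHStrict h lam) {r s : ℕ} (hrs : r < s)
    (he : lam.parts r = lam.parts s) : lam.parts r = 0 ∨ h ∣ lam.parts r := by
  have h1 := lam.anti (show r + 1 ≤ s from hrs)
  rcases hs r with h2 | h2 | h2
  · omega
  · exact Or.inr h2.2
  · exact Or.inl h2

lemma count_partsM (lam : BPartition) (c : ℕ) :
    (partsM lam).count c = (lam.parts.support.filter (fun r => c = lam.parts r)).card := by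
  unfold partsM
  rw [Multiset.count_map]
  rfl

lemma count_le {h : ℕ} {lam : BPartition} (hs : IsHStrict h lam) {c : ℕ} (hc : ¬ h ∣ c) :
    (partsM lam).count c ≤ 1 := by
  rw [count_partsM, Finset.card_le_one]
  intro r hr s hss
  simp only [Finset.mem_filter, Finsupp.mem_support_iff] at hr hss
  by_contra hne
  rcases lt_or_gt_of_ne hne with hl | hl
  · rcases hstrict_ne hs hl (by omega) with h1 | h1
    · exact hr.1 h1
    · exact hc (hr.2 ▸ h1)
  · rcases hstrict_ne hs hl (by omega) with h1 | h1
    · exact hss.1 h1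
    · exact hc (hss.2 ▸ h1)

lemma hstrict_of_count {h : ℕ} {lam : BPartition}
    (hc : ∀ c, ¬ h ∣ c → (partsM lam).count c ≤ 1) : IsHStrict h lam := by
  intro r
  by_contra hcon
  push Not at hcon
  obtain ⟨h1, h2, h3⟩ := hcon
  have h4 := lam.antitone r
  have h5 := hc _ (h2 (by omega))
  rw [count_partsM, Finset.card_le_one] at h5
  have := h5 r (by simp [h3]) (r+1) (by simp; omega)
  omega

lemma exists_of_multiset (M : Multiset ℕ) (h0 : 0 ∉ M) : ∃ lam : BPartition, partsM lam = M := by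
  obtain ⟨L, hL, hs⟩ : ∃ L : List ℕ, (L : Multiset ℕ) = M ∧ L.Pairwise (· ≥ ·) :=
    ⟨M.sort (· ≥ ·), Multiset.sort_eq _ _, Multiset.pairwise_sort _ _⟩
  subst hL
  have hpos : ∀ r, L.getD r 0 ≠ 0 ↔ r < L.length := by
    intro r
    constructor
    · intro h
      by_contra hc
      apply h
      simp [List.getD_eq_getElem?_getD, List.getElem?_eq_none (not_lt.1 hc)]
    · intro h he
      rw [List.getD_eq_getElem _ _ h] at he
      apply h0
      rw [← he]
      exact Multiset.mem_coe.2 (List.getElem_mem h)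
  refine ⟨⟨Finsupp.onFinset (Finset.range L.length) (fun r => L.getD r 0) ?_, ?_⟩, ?_⟩
  · intro a ha
    exact Finset.mem_range.2 ((hpos a).1 ha)
  · intro r
    simp only [Finsupp.onFinset_apply]
    by_cases h1 : r + 1 < L.length
    · rw [List.getD_eq_getElem _ _ h1, List.getD_eq_getElem _ _ (by omega : r < L.length)]
      exact List.pairwise_iff_getElem.1 hs r (r+1) (by omega) h1 (by omega)
    · have : L.getD (r+1) 0 = 0 := by
        by_contra hh
        exact h1 ((hpos _).1 hh)
      rw [this]; exact Nat.zero_le _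
  · unfold partsM
    have hsup : (Finsupp.onFinset (Finset.range L.length) (fun r => L.getD r 0)
      (fun a ha => Finset.mem_range.2 ((hpos a).1 ha))).support = Finset.range L.length := by
      ext r
      simp only [Finsupp.mem_support_iff, Finsupp.onFinset_apply, Finset.mem_range]
      exact hpos r
    simp only [hsup, Finsupp.onFinset_apply]
    show Multiset.map _ (Multiset.range L.length) = _
    unfold Multiset.range
    rw [Multiset.map_coe]
    congr 1
    apply List.ext_getElem
    · simp
    · intro k h1 h2
      simp [List.getElem?_eq_getElem h2]

lemma core_down {h : ℕ} {σ : BPartition} (hσ : IsBarCore h σ) {v : ℕ} (hv : v ∈ partsM σ)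
    (hlt : h < v) : ¬ h ∣ v ∧ v - h ∈ partsM σ := by
  have h0 : 0 ∉ partsM σ := fun hh => by have := ((mem_partsM _ _).1 hh).1; omega
  by_contra hcon
  obtain ⟨mu, hmu⟩ := exists_of_multiset ((v - h) ::ₘ (partsM σ).erase v) (by
    simp only [Multiset.mem_cons, not_or]
    exact ⟨by omega, fun hh => h0 (Multiset.mem_of_mem_erase hh)⟩)
  refine hσ.2 mu ⟨v, hstrict_of_count ?_, Or.inr (Or.inl ⟨hlt, hv, hmu⟩)⟩
  intro c hc
  rw [hmu, Multiset.count_cons]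
  have h1 := count_le hσ.1 hc
  have h2 := Multiset.count_le_of_le c (Multiset.erase_le v (partsM σ))
  split_ifs with he
  · have hnd : ¬ h ∣ v := fun hd => hc (he ▸ Nat.dvd_sub hd (dvd_refl h))
    have h3 : v - h ∉ partsM σ := fun hm => hcon ⟨hnd, hm⟩
    rw [← he] at h3
    have := Multiset.count_eq_zero_of_notMem h3
    omega
  · omega

lemma core_ne {h : ℕ} {σ : BPartition} (hσ : IsBarCore h σ) : h ∉ partsM σ := by
  intro hv
  have h0 : 0 ∉ partsM σ := fun hh => by have := ((mem_partsM _ _).1 hh).1; omega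
  obtain ⟨mu, hmu⟩ := exists_of_multiset ((partsM σ).erase h) (
    fun hh => h0 (Multiset.mem_of_mem_erase hh))
  refine hσ.2 mu ⟨h, hstrict_of_count ?_, Or.inl ⟨rfl, hv, hmu⟩⟩
  intro c hc
  rw [hmu]
  have h1 := count_le hσ.1 hc
  have h2 := Multiset.count_le_of_le c (Multiset.erase_le h (partsM σ))
  omega

lemma core_sum {h : ℕ} {σ : BPartition} (hσ : IsBarCore h σ) (hodd : h % 2 = 1)
    {a b : ℕ} (hab : a + b = h) (ha : a ∈ partsM σ) (hb : b ∈ partsM σ) : False := by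
  have h0 : 0 ∉ partsM σ := fun hh => by have := ((mem_partsM _ _).1 hh).1; omega
  obtain ⟨mu, hmu⟩ := exists_of_multiset (((partsM σ).erase a).erase b) (
    fun hh => h0 (Multiset.mem_of_mem_erase (Multiset.mem_of_mem_erase hh)))
  refine hσ.2 mu ⟨max a b, hstrict_of_count ?_, Or.inr (Or.inr ⟨a, b, hab, ha, ?_, rfl, hmu⟩)⟩
  · intro c hc
    rw [hmu]
    have h1 := count_le hσ.1 hc
    have h2 := Multiset.count_le_of_le c (Multiset.erase_le a (partsM σ))
    have h3 := Multiset.count_le_of_le c (Multiset.erase_le b ((partsM σ).erase a))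
    omega
  · exact (Multiset.mem_erase_of_ne (by omega)).2 hb

/-- combinatorial data of a core -/
structure CoreSet (h : ℕ) (S : ℕ → Prop) : Prop where
  pos : ∀ v, S v → 0 < v
  down : ∀ v k, 0 < v → S (v + h * k) → S v
  ndvd : ∀ v, S v → ¬ h ∣ v
  sum : ∀ u v, S u → S v → ¬ h ∣ u + v

lemma coreSet {h : ℕ} {σ : BPartition} (hσ : IsBarCore h σ) (hodd : h % 2 = 1) :
    CoreSet h (fun v => v ∈ partsM σ) := by
  have pos : ∀ v, v ∈ partsM σ → 0 < v := fun v hv => ((mem_partsM _ _).1 hv).1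
  have down : ∀ k v, 0 < v → v + h * k ∈ partsM σ → v ∈ partsM σ := by
    intro k
    induction k with
    | zero => intro v _ hv; simpa using hv
    | succ k ih =>
      intro v hv hm
      apply ih v hv
      have := (core_down hσ hm (by rw [Nat.mul_succ]; omega)).2
      rw [Nat.mul_succ, ← Nat.add_assoc, Nat.add_sub_cancel] at this
      exact this
  have ndvd : ∀ v, v ∈ partsM σ → ¬ h ∣ v := by
    intro v hv hd
    rcases lt_trichotomy v h with h1 | h1 | h1
    · exact absurd (Nat.le_of_dvd (pos v hv) hd) (by omega)
    · exact core_ne hσ (h1 ▸ hv)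
    · exact (core_down hσ hv h1).1 hd
  refine ⟨pos, fun v k => down k v, ndvd, ?_⟩
  intro u v hu hv hd
  have hm : ∀ u, u ∈ partsM σ → u % h ∈ partsM σ ∧ 0 < u % h := by
    intro u hu
    have h1 : 0 < u % h := Nat.pos_of_ne_zero fun hh => ndvd u hu (Nat.dvd_of_mod_eq_zero hh)
    exact ⟨down (u / h) _ h1 (by rw [Nat.mod_add_div]; exact hu), h1⟩
  obtain ⟨h1, h2⟩ := hm u hu
  obtain ⟨h3, h4⟩ := hm v hv
  refine core_sum hσ hodd ?_ h1 h3
  have h5 : h ∣ u % h + v % h := by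
    rw [Nat.dvd_iff_mod_eq_zero] at hd ⊢
    rw [← Nat.add_mod]; exact hd
  have h6 := Nat.mod_lt u (show 0 < h by omega)
  have h7 := Nat.mod_lt v (show 0 < h by omega)
  obtain ⟨q, hq⟩ := h5
  have : q = 1 := by
    rcases q with _ | _ | q
    · simp at hq; omega
    · rfl
    · have e : h * (q + 1 + 1) = h * q + 2 * h := by ring
      nlinarith
  subst this; omega

/-- Description of weight one partitions -/
lemma step_cases {h : ℕ} (hpos : 1 < h) (hodd : h % 2 = 1) {σ lam : BPartition}
    (hσ : IsBarCore h σ) (hl : IsHStrict h lam) (hst : barStep h lam σ) :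
    (∀ z, z ∈ partsM lam ↔ z ∈ partsM σ ∨ z = h) ∨
    (∃ u, u ∈ partsM σ ∧ u + h ∉ partsM σ ∧
      ∀ z, z ∈ partsM lam ↔ (z ∈ partsM σ ∧ z ≠ u) ∨ z = u + h) ∨
    (∃ a b, a + b = h ∧ 0 < a ∧ 0 < b ∧ a ∉ partsM σ ∧ b ∉ partsM σ ∧
      ∀ z, z ∈ partsM lam ↔ z ∈ partsM σ ∨ z = a ∨ z = b) := by
  have C := coreSet hσ hodd
  obtain ⟨v, hs, h1 | h1 | h1⟩ := hst
  · left
    obtain ⟨rfl, h2, h3⟩ := h1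
    intro z
    rw [h3]
    rw [← Multiset.cons_erase h2]
    simp [or_comm]
  · right; left
    obtain ⟨h1, h2, h3⟩ := h1
    have hm : v - h ∈ partsM σ := by rw [h3]; exact Multiset.mem_cons_self _ _
    have hnd := C.ndvd _ hm
    have hndv : ¬ h ∣ v := fun hd => hnd (Nat.dvd_sub hd (dvd_refl h))
    have hv1 := count_le hl hndv
    have hv2 : v ∉ (partsM lam).erase v := by
      intro hh
      have := Multiset.count_pos.2 hh
      rw [Multiset.count_erase_self] at this
      omega
    have hvh : v - h + h = v := by omega
    have hu1 := count_le hs hnd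
    have hu2 : v - h ∉ (partsM lam).erase v := by
      intro hh
      have := Multiset.count_pos.2 hh
      rw [h3, Multiset.count_cons_self] at hu1
      omega
    refine ⟨v - h, hm, ?_, ?_⟩
    · rw [hvh, h3]
      simp only [Multiset.mem_cons, not_or]
      exact ⟨by omega, hv2⟩
    · intro z
      rw [hvh, h3]
      conv_lhs => rw [← Multiset.cons_erase h2]
      simp only [Multiset.mem_cons]
      constructor
      · rintro (rfl | hz)
        · exact Or.inr rfl
        · exact Or.inl ⟨Or.inr hz, fun hh => hu2 (hh ▸ hz)⟩
      · rintro (⟨h4 | h4, h5⟩ | h4)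
        · exact absurd h4 h5
        · exact Or.inr h4
        · exact Or.inl h4
  · right; right
    obtain ⟨a, b, hab, ha, hb, -, h3⟩ := h1
    have ha0 := ((mem_partsM _ _).1 ha).1
    have hb0 := ((mem_partsM _ _).1 (Multiset.mem_of_mem_erase hb)).1
    have nd : ∀ x, 0 < x → x < h → ¬ h ∣ x := fun x h1 h2 h3 =>
      absurd (Nat.le_of_dvd h1 h3) (by omega)
    have ca := count_le hl (nd a ha0 (by omega))
    have cb := count_le hl (nd b hb0 (by omega))
    refine ⟨a, b, hab, ha0, hb0, ?_, ?_, ?_⟩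
    · rw [h3]
      intro hh
      have := Multiset.count_pos.2 (Multiset.mem_of_mem_erase hh)
      rw [Multiset.count_erase_self] at this
      omega
    · rw [h3]
      intro hh
      have := Multiset.count_pos.2 hh
      rw [Multiset.count_erase_self, Multiset.count_erase_of_ne (by omega)] at this
      omega
    · intro z
      rw [h3]
      conv_lhs => rw [← Multiset.cons_erase ha, ← Multiset.cons_erase hb]
      simp only [Multiset.mem_cons]
      tauto

lemma res_char {h c : ℕ} (hh : 1 < h) (hc : 1 ≤ c) :
    (c % h = 0 ∧ colRes h c = 0) ∨
    (1 ≤ c % h ∧ c % h < h ∧ colRes h c = min (c % h - 1) (h - c % h)) := by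
  unfold colRes
  have h1 := Nat.mod_lt c (show 0 < h by omega)
  rcases Nat.eq_zero_or_pos (c % h) with h0 | h0
  · left; simp [h0]
  · right
    refine ⟨h0, h1, ?_⟩
    have h2 : (c - 1) % h = c % h - 1 := by
      have h3 := Nat.mod_add_div c h
      have h4 : c - 1 = (c % h - 1) + h * (c / h) := by omega
      rw [h4, Nat.add_mul_mod_self_left, Nat.mod_eq_of_lt (by omega)]
    rw [h2, Nat.mod_eq_of_lt (show h - c % h < h by omega)]

lemma res_succ {h c : ℕ} (hh : 1 < h) (hodd : h % 2 = 1) (hc : 1 ≤ c)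
    (he : colRes h c = colRes h (c + 1)) : colRes h c = 0 := by
  have h1 : (c + 1) % h = if c % h = h - 1 then 0 else c % h + 1 := by
    have h3 := Nat.mod_add_div c h
    have h2 := Nat.mod_lt c (show 0 < h by omega)
    split_ifs with hq
    · have : c + 1 = h * (c / h + 1) := by rw [Nat.mul_succ]; omega
      rw [this, Nat.mul_mod_right]
    · have : c + 1 = (c % h + 1) + h * (c / h) := by omega
      rw [this, Nat.add_mul_mod_self_left, Nat.mod_eq_of_lt (by omega)]
  have a := res_char hh hc
  have b := res_char hh (show 1 ≤ c + 1 by omega)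
  split_ifs at h1 <;> omega

lemma res_eq {h c d : ℕ} (hh : 1 < h) (hc : 1 ≤ c) (hd : 1 ≤ d)
    (he : colRes h (c + 1) = colRes h (d + 1)) (hi : colRes h (c + 1) ≠ 0) :
    c % h = d % h ∨ h ∣ c + d + 1 := by
  have a := res_char hh (show 1 ≤ c + 1 by omega)
  have b := res_char hh (show 1 ≤ d + 1 by omega)
  have h3 := Nat.mod_add_div (c+1) h
  have h4 := Nat.mod_add_div (d+1) h
  have : (c+1) % h = (d+1) % h ∨ (c + 1) % h + (d+1) % h = h + 1 := by omega
  rcases this with h5 | h5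
  · left
    exact Nat.ModEq.add_right_cancel' 1 h5
  · right
    refine ⟨(c+1)/h + (d+1)/h + 1, ?_⟩
    rw [Nat.mul_add, Nat.mul_add]; omega

lemma res_zero {h c : ℕ} (hh : 1 < h) (hc : 1 ≤ c) (he : colRes h c = 0) :
    h ∣ c ∨ c % h = 1 := by
  rcases res_char hh hc with a | a
  · exact Or.inl (Nat.dvd_of_mod_eq_zero a.1)
  · right; omega

lemma res_dvd {h c : ℕ} (hh : 1 < h) (hc : 1 ≤ c) (he : h ∣ c) : colRes h c = 0 := by
  have := Nat.mod_eq_zero_of_dvd he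
  rcases res_char hh hc with a | a <;> omega

lemma res_one {h : ℕ} (hh : 1 < h) : colRes h 1 = 0 := by
  rcases res_char hh (le_refl 1) with a | a
  · exact a.2
  · rw [Nat.mod_eq_of_lt hh] at a; omega

lemma addable_ne {h i : ℕ} (hh : 1 < h) (hodd : h % 2 = 1) (hi : i ≠ 0) {σ : BPartition}
    {x : ℕ × ℕ} (hx : Addable h i σ x) :
    ∃ u, u ∈ partsM σ ∧ u + 1 ∉ partsM σ ∧ colRes h (u + 1) = i := by
  obtain ⟨hr, hnd, nu, hnu, hsub, hmem, hall⟩ := hx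
  obtain ⟨r, c⟩ := x
  simp only [diagram, Set.mem_setOf_eq, Prod.forall, Set.subset_def] at *
  have h1 := hall r (σ.parts r + 1) ⟨by omega, by omega⟩ (by omega)
  refine ⟨σ.parts r, (mem_partsM _ _).2 ⟨Nat.pos_of_ne_zero ?_, r, rfl⟩, ?_, h1⟩
  · intro h0
    rw [h0, Nat.zero_add, res_one hh] at h1
    exact hi h1.symm
  · intro hm
    obtain ⟨-, s, hs⟩ := (mem_partsM _ _).1 hm
    have hsr : s < r := by
      by_contra hc
      have := σ.anti (not_lt.1 hc)
      omega
    have h2 := hsub s (σ.parts s) ⟨by omega, le_refl _⟩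
    have h3 : nu.parts s ≤ σ.parts s := by
      by_contra hc
      have h4 := hall s (σ.parts s + 1) ⟨by omega, by omega⟩ (by omega)
      rw [hs] at h4
      have := res_succ hh hodd (by omega) (h1.trans h4.symm)
      omega
    have h5 := nu.anti hsr.le
    have h6 := hstrict_ne hnu hsr (by omega)
    have h7 : nu.parts s = σ.parts r + 1 := by omega
    rw [h7] at h6
    have := res_dvd hh (by omega) (h6.resolve_left (by omega))
    omega

lemma removable_ne {h i : ℕ} (hh : 1 < h) (hodd : h % 2 = 1) (hi : i ≠ 0) {lam : BPartition}
    {x : ℕ × ℕ} (hx : Removable h i lam x) :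
    ∃ w, 0 < w ∧ w ∉ partsM lam ∧ w + 1 ∈ partsM lam ∧ colRes h (w + 1) = i := by
  obtain ⟨hmem, mu, hmu, hsub, hnd, hall⟩ := hx
  obtain ⟨r, c⟩ := x
  simp only [diagram, Set.mem_setOf_eq, Prod.forall, Set.subset_def] at *
  have h1 := hall r (lam.parts r) ⟨by omega, by omega⟩ (by omega)
  obtain ⟨w, hw⟩ : ∃ w, lam.parts r = w + 1 := ⟨lam.parts r - 1, by omega⟩
  rw [hw] at h1
  have hw0 : 0 < w := by
    apply Nat.pos_of_ne_zero
    rintro rfl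
    rw [Nat.zero_add, res_one hh] at h1
    exact hi h1.symm
  have key : ∀ s, w ≤ lam.parts s → w ≤ mu.parts s := by
    intro s hs
    by_contra hc
    have h2 := hall s w ⟨by omega, by omega⟩ (by omega)
    have := res_succ hh hodd hw0 (h2.trans h1.symm)
    omega
  refine ⟨w, hw0, ?_, (mem_partsM _ _).2 ⟨by omega, r, hw⟩, h1⟩
  intro hm
  obtain ⟨-, s, hs⟩ := (mem_partsM _ _).1 hm
  have hsr : r < s := by
    by_contra hc
    have := lam.anti (not_lt.1 hc)
    omega
  have h2 := key s (by omega)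
  have h3 := mu.anti hsr.le
  have h4 : mu.parts r = w := by omega
  have h6 := hstrict_ne hmu hsr (by omega)
  rw [h4] at h6
  have h7 := h6.resolve_left (by omega)
  have h8 : (w + 1) % h = 1 := by
    obtain ⟨q, rfl⟩ := h7
    rw [Nat.add_comm, Nat.add_mul_mod_self_left, Nat.mod_eq_of_lt hh]
  rcases res_char hh (show 1 ≤ w + 1 by omega) with a | a <;> omega

lemma CoreSet.le {h : ℕ} {S : ℕ → Prop} (C : CoreSet h S) {u v : ℕ} (hu : S u) (hv : 0 < v)
    (hle : v ≤ u) (hm : v % h = u % h) : S v := by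
  obtain ⟨k, hk⟩ := (Nat.modEq_iff_dvd' hle).1 hm
  exact C.down v k hv (by rw [← hk, Nat.add_sub_cancel' hle]; exact hu)

lemma mod_le_add {h u w : ℕ} (hm : w % h = u % h) (hlt : u < w) : u + h ≤ w := by
  obtain ⟨k, hk⟩ := (Nat.modEq_iff_dvd' hlt.le).1 hm.symm
  have : h ∣ w - u := ⟨k, hk⟩
  have := Nat.le_of_dvd (by omega) this
  omega

lemma main_ne {h : ℕ} (hh : 1 < h) {S L : ℕ → Prop} (C : CoreSet h S)
    (hL : (∀ z, L z ↔ S z ∨ z = h) ∨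
    (∃ u, S u ∧ ¬ S (u + h) ∧ ∀ z, L z ↔ (S z ∧ z ≠ u) ∨ z = u + h) ∨
    (∃ a b, a + b = h ∧ 0 < a ∧ 0 < b ∧ ¬ S a ∧ ¬ S b ∧ ∀ z, L z ↔ S z ∨ z = a ∨ z = b))
    {u w : ℕ} (hu : S u) (hu1 : ¬ S (u + 1)) (hw0 : 0 < w) (hw : ¬ L w) (hw1 : L (w + 1))
    (hne : ¬ h ∣ w + 1) (hres : w % h = u % h ∨ h ∣ w + u + 1) : False := by
  have hu0 := C.pos u hu
  have base : ¬ S w → S (w + 1) → False := by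
    intro h1 h2
    rcases hres with h3 | h3
    · rcases le_or_gt w u with h4 | h4
      · exact h1 (C.le hu hw0 h4 h3)
      · exact hu1 (C.le h2 (by omega) (by omega) ((Nat.ModEq.add_right 1 h3.symm)))
    · exact C.sum _ _ h2 hu (by rw [show w + 1 + u = w + u + 1 by ring]; exact h3)
  rcases hL with hL | ⟨t, ht, ht1, hL⟩ | ⟨a, b, hab, ha, hb, ha1, hb1, hL⟩
  · rw [hL] at hw hw1
    rcases hw1 with h1 | h1
    · exact base (fun h2 => hw (Or.inl h2)) h1
    · exact hne (h1 ▸ dvd_refl _)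
  · rw [hL] at hw hw1
    rcases hw1 with ⟨h1, h2⟩ | h1
    · by_cases h3 : S w
      · have h4 : w = t := by
          by_contra h5
          exact hw (Or.inl ⟨h3, h5⟩)
        subst h4
        rcases hres with h5 | h5
        · have h6 : w < u := by
            by_contra h6
            exact hu1 (C.le h1 (by omega) (by omega) ((Nat.ModEq.add_right 1 h5.symm)))
          have := mod_le_add h5.symm h6
          exact ht1 (C.le hu (by omega) this (by simpa using h5))
        · exact C.sum _ _ h1 hu (by rw [show w + 1 + u = w + u + 1 by ring]; exact h5)
      · exact base h3 h1
    · have h2 : ¬ S w := fun h3 => hw (Or.inl ⟨h3, by omega⟩)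
      rcases hres with h3 | h3
      · have h4 : u < w := by
          by_contra h4
          exact h2 (C.le hu hw0 (by omega) h3)
        have := mod_le_add h3 h4
        refine hu1 (C.le ht (by omega) (by omega) ?_)
        have h6 : (w + 1) % h = (u + 1) % h := Nat.ModEq.add_right 1 h3
        rw [← h6, h1, Nat.add_mod_right]
      · apply C.sum _ _ ht hu
        have : w + u + 1 = t + u + h := by omega
        rw [this] at h3
        exact (Nat.dvd_add_left (dvd_refl h)).1 h3
  · rw [hL] at hw hw1
    have h2 : ¬ S w := fun h3 => hw (Or.inl h3)
    have aux : ∀ a b, a + b = h → 0 < a → 0 < b → ¬ S a → ¬ S b → w + 1 = a → False := by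
      intro a b hab ha hb ha1 hb1 h1
      rcases hres with h3 | h3
      · have h4 : w % h = w := Nat.mod_eq_of_lt (by omega)
        have h5 := Nat.mod_le u h
        exact h2 (C.le hu hw0 (by omega) h3)
      · have h4 : b % h = b := Nat.mod_eq_of_lt (by omega)
        have h6 : b % h = u % h := by
          have : (b + (w + 1)) % h = (u + (w + 1)) % h := by
            rw [show b + (w + 1) = h by omega, show u + (w+1) = w + u + 1 by ring,
              Nat.mod_self, Nat.mod_eq_zero_of_dvd h3]
          exact Nat.ModEq.add_right_cancel' _ this
        have h5 := Nat.mod_le u h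
        exact hb1 (C.le hu hb (by omega) h6)
    rcases hw1 with h1 | h1 | h1
    · exact base h2 h1
    · exact aux a b hab ha hb ha1 hb1 h1
    · exact aux b a (by omega) hb ha hb1 ha1 h1

lemma addable_zero {h : ℕ} (hh : 2 < h) (hodd : h % 2 = 1) {σ : BPartition}
    (C : CoreSet h (fun v => v ∈ partsM σ)) (hno : h - 1 ∉ partsM σ) :
    Set.ncard {x : ℕ × ℕ | Addable h 0 σ x} ≤ 1 := by
  have r2 : colRes h 2 ≠ 0 := by
    have := Nat.mod_eq_of_lt hh
    rcases res_char (by omega : 1 < h) (show 1 ≤ 2 by omega) with a | a <;> omega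
  have key : ∀ r c, Addable h 0 σ (r, c) → σ.parts r = 0 ∧ c = 1 ∧ ∀ s < r, σ.parts s ≠ 0 := by
    rintro r c ⟨hr, hnd, nu, hnu, hsub, hmem, hall⟩
    simp only [diagram, Set.mem_setOf_eq, Prod.forall, Set.subset_def] at *
    have h1 := hall r (σ.parts r + 1) ⟨by omega, by omega⟩ (by omega)
    have h0 : σ.parts r = 0 := by
      by_contra h0
      have hm : σ.parts r ∈ partsM σ := (mem_partsM _ _).2 ⟨by omega, r, rfl⟩
      rcases res_zero (by omega : 1 < h) (by omega) h1 with h2 | h2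
      · apply hno
        apply C.le hm (by omega)
        · have := Nat.le_of_dvd (by omega) h2
          omega
        · have : (h - 1 + 1) % h = (σ.parts r + 1) % h := by
            rw [Nat.mod_eq_zero_of_dvd h2, Nat.sub_add_cancel (by omega), Nat.mod_self]
          exact Nat.ModEq.add_right_cancel' 1 this
      · have h3 : (σ.parts r + 1) % h = (0 + 1) % h := by
          rw [h2, Nat.zero_add, Nat.mod_eq_of_lt (by omega)]
        have h4 : σ.parts r % h = 0 % h := Nat.ModEq.add_right_cancel' 1 h3
        rw [Nat.zero_mod] at h4
        exact C.ndvd _ hm (Nat.dvd_of_mod_eq_zero h4)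
    have two : ∀ s, σ.parts s = 0 → nu.parts s ≤ 1 := by
      intro s hs
      by_contra hc
      exact r2 (hall s 2 ⟨by omega, by omega⟩ (by omega))
    have := two r h0
    refine ⟨h0, by omega, ?_⟩
    intro s hs hs0
    have h5 := two s hs0
    have h6 := nu.anti hs.le
    rcases hstrict_ne hnu hs (by omega) with h7 | h7
    · omega
    · rw [show nu.parts s = 1 by omega] at h7
      have := Nat.le_of_dvd (by omega) h7
      omega
  have hsub : Set.Subsingleton {x : ℕ × ℕ | Addable h 0 σ x} := by
    rintro ⟨r, c⟩ h1 ⟨s, d⟩ h2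
    obtain ⟨a1, a2, a3⟩ := key r c h1
    obtain ⟨b1, b2, b3⟩ := key s d h2
    have : r = s := by
      rcases lt_trichotomy r s with h | h | h
      · exact absurd a1 (b3 r h)
      · exact h
      · exact absurd b1 (a3 s h)
    rw [this, a2, b2]
  exact (Set.ncard_le_one hsub.finite).2 (fun a ha b hb => hsub ha hb)

lemma main_zero {h : ℕ} (hh : 2 < h) {σ lam : BPartition}
    (C : CoreSet h (fun v => v ∈ partsM σ)) (hm : h - 1 ∈ partsM σ)
    (hL : (∀ z, z ∈ partsM lam ↔ z ∈ partsM σ ∨ z = h) ∨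
    (∃ u, u ∈ partsM σ ∧ u + h ∉ partsM σ ∧
      ∀ z, z ∈ partsM lam ↔ (z ∈ partsM σ ∧ z ≠ u) ∨ z = u + h) ∨
    (∃ a b, a + b = h ∧ 0 < a ∧ 0 < b ∧ a ∉ partsM σ ∧ b ∉ partsM σ ∧
      ∀ z, z ∈ partsM lam ↔ z ∈ partsM σ ∨ z = a ∨ z = b))
    {x : ℕ × ℕ} (hx : Removable h 0 lam x) : False := by
  obtain ⟨hmem, mu, hmu, hsub, hnd, hall⟩ := hx
  obtain ⟨r, c⟩ := x
  simp only [diagram, Set.mem_setOf_eq, Prod.forall, Set.subset_def] at hmem hsub hnd hall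
  have h1 := hall r (lam.parts r) ⟨by omega, by omega⟩ (by omega)
  have hl : lam.parts r ∈ partsM lam := (mem_partsM _ _).2 ⟨by omega, r, rfl⟩
  have hz := res_zero (by omega : 1 < h) (by omega) h1
  have one : ∀ t, t ∈ partsM σ → t % h ≠ 1 := by
    intro t ht h2
    apply C.sum _ _ ht hm
    rw [Nat.dvd_iff_mod_eq_zero, Nat.add_mod, h2, Nat.mod_eq_of_lt (show h - 1 < h by omega),
      show 1 + (h - 1) = h by omega, Nat.mod_self]
  have inS : ∀ t, t ∈ partsM σ → ¬ (h ∣ t ∨ t % h = 1) := by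
    rintro t ht (h2 | h2)
    · exact C.ndvd _ ht h2
    · exact one t ht h2
  rcases hL with hL | ⟨t, ht, ht1, hL⟩ | ⟨a, b, hab, ha, hb, ha1, hb1, hL⟩
  · rcases (hL _).1 hl with h2 | h2
    · exact inS _ h2 hz
    · have h3 := (hL (h - 1)).2 (Or.inl hm)
      obtain ⟨-, s, hs⟩ := (mem_partsM _ _).1 h3
      have hsr : r < s := by
        by_contra hc
        have := lam.anti (not_lt.1 hc)
        omega
      have h4 : h - 1 ≤ mu.parts s := by
        by_contra hc
        have h5 := hall s (h - 1) ⟨by omega, by omega⟩ (by omega)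
        have h6 := Nat.mod_eq_of_lt (show h - 1 < h by omega)
        rcases res_char (by omega : 1 < h) (show 1 ≤ h - 1 by omega) with a | a <;> omega
      have h5 := mu.anti hsr.le
      rcases hstrict_ne hmu hsr (by omega) with h7 | h7
      · omega
      · have := Nat.le_of_dvd (by omega) h7
        omega
  · rcases (hL _).1 hl with h2 | h2
    · exact inS _ h2.1 hz
    · apply inS t ht
      rw [h2, Nat.add_mod_right] at hz
      exact hz.imp_left (fun h3 => (Nat.dvd_add_left (dvd_refl h)).1 h3)
  · have aux : ∀ a b, a + b = h → 0 < a → 0 < b → b ∉ partsM σ → lam.parts r = a → False := by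
      intro a b hab ha hb hb1 h2
      rw [h2] at hz
      rcases hz with h3 | h3
      · have := Nat.le_of_dvd ha h3
        omega
      · rw [Nat.mod_eq_of_lt (by omega)] at h3
        rw [show b = h - 1 by omega] at hb1
        exact hb1 hm
    rcases (hL _).1 hl with h2 | h2 | h2
    · exact inS _ h2 hz
    · exact aux a b hab ha hb hb1 h2
    · exact aux b a (by omega) hb ha ha1 h2

end BPartition

open BPartition in
/-- If σ is an h-bar-core with at least one addable i-node, and moreover i ≠ 0 or σ
has at least three addable 0-nodes, then no partition in P_{σ,1} has a removable
i-node. -/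
theorem stmt6 (n h : ℕ) (hn : 1 ≤ n) (hh : h = 2 * n + 1) (i : ℕ) (hi : i ≤ n)
    (σ : BPartition) (hσ : IsBarCore h σ) (hadd : ∃ x, Addable h i σ x)
    (hcase : i ≠ 0 ∨ 3 ≤ Set.ncard {x : ℕ × ℕ | Addable h 0 σ x}) :
    ∀ lam, InBlock h σ 1 lam → ∀ x, ¬ Removable h i lam x := by
  have hodd : h % 2 = 1 := by omega
  have h1 : 1 < h := by omega
  rintro lam ⟨hl, -, nu, hst, hnu⟩ x hx
  have hnu' : nu = σ := hnu
  subst hnu'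
  have C := coreSet hσ hodd
  have hL := step_cases h1 hodd hσ hl hst
  by_cases hi0 : i = 0
  · subst hi0
    have h3 := hcase.resolve_left (by simp)
    have hm : h - 1 ∈ partsM nu := by
      by_contra hno
      have := addable_zero (by omega) hodd C hno
      omega
    exact main_zero (by omega) C hm hL hx
  · obtain ⟨y, hy⟩ := hadd
    obtain ⟨u, hu, hu1, hur⟩ := addable_ne h1 hodd hi0 hy
    obtain ⟨w, hw0, hw, hw1, hwr⟩ := removable_ne h1 hodd hi0 hx
    have hu0 := C.pos u hu
    refine main_ne h1 (L := fun z => z ∈ partsM lam) C hL hu hu1 hw0 hw hw1 ?_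
      (res_eq h1 hw0 hu0 (hwr.trans hur.symm) (by omega))
    intro hd
    have := res_dvd h1 (by omega) hd
    omega
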